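/- arXiv:2603.11953 — 5 statements merged into one kernel-verified Lean document; each statement's English description precedes it below -/
import Mathlib

section
/- Let A be a real m×n matrix, let Ṽ be a real n×n orthogonal matrix, let Σ̂ be a real n×n diagonal matrix with positive diagonal entries, let Û be a real m×n matrix, and let ε ≥ 0. Assume the entrywise bound |Û − A Ṽ Σ̂⁻¹| ≤ ε |A| |Ṽ| Σ̂⁻¹. Then the matrix ΔA := Û Σ̂ Ṽᵀ − A satisfies, for every row index i ≤ m, ‖ΔA(i,:)‖₂ ≤ √n · ε · ‖A(i,:)‖₂. -/
open Matrix BigOperators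

/-- Euclidean norm of a vector. -/
noncomputable def vnorm {k : ℕ} (v : Fin k → ℝ) : ℝ := Real.sqrt (∑ i, (v i)^2)

/-- Spectral norm (operator 2-norm) of a real matrix. -/
noncomputable def spec {m n : ℕ} (A : Matrix (Fin m) (Fin n) ℝ) : ℝ :=
  ‖(Matrix.toEuclideanLin A).toContinuousLinearMap‖

/-- Moore–Penrose pseudoinverse of a full-column-rank matrix. -/
noncomputable def pinv {m n : ℕ} (A : Matrix (Fin m) (Fin n) ℝ) : Matrix (Fin n) (Fin m) ℝ :=
  (Aᵀ * A)⁻¹ * Aᵀ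

/-- Condition number κ(B) = ‖B‖ ‖B†‖. -/
noncomputable def kappa {m n : ℕ} (B : Matrix (Fin m) (Fin n) ℝ) : ℝ :=
  spec B * spec (pinv B)

theorem vnorm_sq {k : ℕ} (v : Fin k → ℝ) : vnorm v ^ 2 = ∑ i, v i ^ 2 :=
  Real.sq_sqrt (Finset.sum_nonneg fun _ _ => sq_nonneg _)

theorem vnorm_nonneg {k : ℕ} (v : Fin k → ℝ) : 0 ≤ vnorm v := Real.sqrt_nonneg _

theorem vnorm_sq_eq_dotProduct {k : ℕ} (v : Fin k → ℝ) : vnorm v ^ 2 = v ⬝ᵥ v := by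
  rw [vnorm_sq]
  simp only [dotProduct, sq]

/-- Right multiplication by the transpose of a matrix with orthonormal columns preserves the
Euclidean norm. -/
theorem vnorm_vecMul_transpose {k n : ℕ} {V : Matrix (Fin k) (Fin n) ℝ} (hV : Vᵀ * V = 1)
    (e : Fin n → ℝ) : vnorm (e ᵥ* Vᵀ) = vnorm e := by
  rw [← sq_eq_sq₀ (vnorm_nonneg _) (vnorm_nonneg _), vnorm_sq_eq_dotProduct,
    vnorm_sq_eq_dotProduct]
  nth_rewrite 2 [vecMul_transpose]
  rw [dotProduct_mulVec, vecMul_vecMul, hV, vecMul_one]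

theorem sum_sq_col_eq_one {k n : ℕ} {V : Matrix (Fin k) (Fin n) ℝ} (hV : Vᵀ * V = 1)
    (j : Fin n) : ∑ i, V i j ^ 2 = 1 := by
  simpa [mul_apply, sq] using congrFun (congrFun hV j) j

theorem vnorm_le_of_abs_le {k n : ℕ} {V : Matrix (Fin k) (Fin n) ℝ} (hV : Vᵀ * V = 1)
    {ε : ℝ} (hε : 0 ≤ ε) (a : Fin k → ℝ) (e : Fin n → ℝ)
    (he : ∀ j, |e j| ≤ ε * ∑ i, |a i| * |V i j|) :
    vnorm e ≤ √n * ε * vnorm a := by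
  refine abs_le_of_sq_le_sq' ?_ (mul_nonneg (by positivity) (vnorm_nonneg a)) |>.2
  rw [mul_pow, mul_pow, Real.sq_sqrt n.cast_nonneg, vnorm_sq, vnorm_sq]
  calc ∑ j, e j ^ 2 ≤ ∑ _j : Fin n, ε ^ 2 * ∑ i, a i ^ 2 := Finset.sum_le_sum fun j _ => by
        calc e j ^ 2 = |e j| ^ 2 := (sq_abs _).symm
          _ ≤ (ε * ∑ i, |a i| * |V i j|) ^ 2 := by gcongr; exact he j
          _ = ε ^ 2 * (∑ i, |a i| * |V i j|) ^ 2 := mul_pow _ _ _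
          _ ≤ ε ^ 2 * ((∑ i, |a i| ^ 2) * ∑ i, |V i j| ^ 2) := by
            gcongr; exact Finset.sum_mul_sq_le_sq_mul_sq _ _ _
          _ = ε ^ 2 * ∑ i, a i ^ 2 := by simp only [sq_abs, sum_sq_col_eq_one hV, mul_one]
    _ = n * ε ^ 2 * ∑ i, a i ^ 2 := by simp [mul_assoc]

/-- rowwise backward error of the computed SVD factors. -/
theorem stmt_0 {m n : ℕ} (A U : Matrix (Fin m) (Fin n) ℝ)
    (V : Matrix (Fin n) (Fin n) ℝ) (hV : Vᵀ * V = 1)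
    (σ : Fin n → ℝ) (hσ : ∀ i, 0 < σ i)
    (ε : ℝ) (hε : 0 ≤ ε)
    (hU : ∀ i j, |U i j - (A * V * Matrix.diagonal (fun i => (σ i)⁻¹)) i j|
      ≤ ε * ((A.map (fun x => |x|) * V.map (fun x => |x|) *
        Matrix.diagonal (fun i => (σ i)⁻¹)) i j)) :
    ∀ i, vnorm (fun j => (U * Matrix.diagonal σ * Vᵀ - A) i j)
      ≤ Real.sqrt n * ε * vnorm (fun j => A i j) := by
  intro i
  have hV' : V * Vᵀ = 1 := mul_eq_one_comm.mp hV
  have hΔ : U * diagonal σ * Vᵀ - A = (U * diagonal σ - A * V) * Vᵀ := by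
    rw [Matrix.sub_mul, Matrix.mul_assoc A, hV', Matrix.mul_one]
  have hrow : (fun j => (U * diagonal σ * Vᵀ - A) i j)
      = (U * diagonal σ - A * V) i ᵥ* Vᵀ := by
    rw [hΔ]; rfl
  rw [hrow, vnorm_vecMul_transpose hV]
  refine vnorm_le_of_abs_le hV hε _ _ fun j => ?_
  have h := mul_le_mul_of_nonneg_right (hU i j) (hσ j).le
  have hne := (hσ j).ne'
  rw [mul_diagonal, mul_diagonal, ← abs_of_pos (hσ j), ← abs_mul, abs_of_pos (hσ j), sub_mul,
    inv_mul_cancel_right₀ hne, mul_assoc ε, inv_mul_cancel_right₀ hne] at h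
  rw [Matrix.sub_apply, mul_diagonal]
  simpa [mul_apply] using h
end

section
/- Let A be a real m×n matrix, Ṽ and V̂ real n×n matrices, Σ̂ a real n×n diagonal matrix with positive diagonal entries, Û a real m×n matrix, and ε_V, ε_U ≥ 0. Assume |V̂ − Ṽ| ≤ ε_V |Ṽ| entrywise and |Û − A V̂ Σ̂⁻¹| ≤ ε_U |A| |V̂| Σ̂⁻¹ entrywise. Then |Û − A Ṽ Σ̂⁻¹| ≤ (ε_V + ε_U(1+ε_V)) |A| |Ṽ| Σ̂⁻¹ entrywise. -/
open Matrix BigOperators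

/-- combining the rounding of V and the computation of U. -/
theorem stmt_1 {m n : ℕ} (A U : Matrix (Fin m) (Fin n) ℝ)
    (Vt Vh : Matrix (Fin n) (Fin n) ℝ)
    (σ : Fin n → ℝ) (hσ : ∀ i, 0 < σ i)
    (εV εU : ℝ) (hεV : 0 ≤ εV) (hεU : 0 ≤ εU)
    (hVh : ∀ i j, |Vh i j - Vt i j| ≤ εV * |Vt i j|)
    (hU : ∀ i j, |U i j - (A * Vh * Matrix.diagonal (fun i => (σ i)⁻¹)) i j|
      ≤ εU * ((A.map (fun x => |x|) * Vh.map (fun x => |x|) *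
        Matrix.diagonal (fun i => (σ i)⁻¹)) i j)) :
    ∀ i j, |U i j - (A * Vt * Matrix.diagonal (fun i => (σ i)⁻¹)) i j|
      ≤ (εV + εU * (1 + εV)) * ((A.map (fun x => |x|) * Vt.map (fun x => |x|) *
        Matrix.diagonal (fun i => (σ i)⁻¹)) i j) := by
  intro i j
  specialize hU i j
  simp only [Matrix.mul_diagonal] at hU ⊢
  simp only [Matrix.mul_apply, Matrix.map_apply] at hU ⊢
  have hs : 0 < (σ j)⁻¹ := inv_pos.mpr (hσ j)
  have hdiff : |∑ k, A i k * Vh k j - ∑ k, A i k * Vt k j|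
      ≤ εV * ∑ k, |A i k| * |Vt k j| := by
    rw [← Finset.sum_sub_distrib, Finset.mul_sum]
    refine (Finset.abs_sum_le_sum_abs _ _).trans (Finset.sum_le_sum fun k _ => ?_)
    rw [← mul_sub, abs_mul, mul_left_comm]
    exact mul_le_mul_of_nonneg_left (hVh k j) (abs_nonneg _)
  have habs : ∑ k, |A i k| * |Vh k j| ≤ (1 + εV) * ∑ k, |A i k| * |Vt k j| := by
    rw [Finset.mul_sum]
    refine Finset.sum_le_sum fun k _ => ?_
    rw [mul_left_comm]
    refine mul_le_mul_of_nonneg_left ?_ (abs_nonneg _)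
    linarith [hVh k j, abs_sub_abs_le_abs_sub (Vh k j) (Vt k j)]
  have hdiff' := mul_le_mul_of_nonneg_right hdiff hs.le
  rw [← abs_of_pos hs, ← abs_mul, abs_of_pos hs, sub_mul] at hdiff'
  have habs' := mul_le_mul_of_nonneg_left (mul_le_mul_of_nonneg_right habs hs.le) hεU
  refine (abs_sub_le _ _ _).trans ((add_le_add (hU.trans habs') hdiff').trans_eq ?_)
  ring
end

section
/- Let A = B·D be a real m×n matrix of full column rank, where D is an n×n diagonal matrix with positive diagonal entries. Let Ṽ be a real n×n orthogonal matrix and let ΔM be a real n×n matrix with |ΔM| ≤ ε |A|ᵀ|A| entrywise for some ε ≥ 0. Then for all indices i, j ≤ n, |(Ṽᵀ ΔM Ṽ)_{ij}| ≤ n² ε κ(B)² ‖A Ṽ(:,i)‖₂ · ‖A Ṽ(:,j)‖₂. -/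
open Matrix BigOperators

theorem vnorm_eq_norm {k : ℕ} (v : Fin k → ℝ) : vnorm v = ‖WithLp.toLp 2 v‖ := by
  simp [vnorm, EuclideanSpace.norm_eq]

theorem spec_nonneg {m n : ℕ} (A : Matrix (Fin m) (Fin n) ℝ) : 0 ≤ spec A := norm_nonneg _

theorem abs_le_vnorm {k : ℕ} (v : Fin k → ℝ) (i : Fin k) : |v i| ≤ vnorm v :=
  Real.abs_le_sqrt (Finset.single_le_sum (f := fun i => v i ^ 2)
    (fun _ _ => sq_nonneg _) (Finset.mem_univ i))

theorem vnorm_mulVec_le {m n : ℕ} (A : Matrix (Fin m) (Fin n) ℝ) (x : Fin n → ℝ) :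
    vnorm (A *ᵥ x) ≤ spec A * vnorm x := by
  rw [vnorm_eq_norm, vnorm_eq_norm]
  exact (Matrix.toEuclideanLin A).toContinuousLinearMap.le_opNorm (WithLp.toLp 2 x)

theorem vnorm_col_le_spec {m n : ℕ} (A : Matrix (Fin m) (Fin n) ℝ) (k : Fin n) :
    vnorm (A.col k) ≤ spec A := by
  have h := vnorm_mulVec_le A (Pi.single k 1)
  rw [Matrix.mulVec_single_one, vnorm_eq_norm (Pi.single k 1)] at h
  simpa using h

theorem sum_abs_mul_abs_le {k : ℕ} (u v : Fin k → ℝ) :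
    ∑ p, |u p| * |v p| ≤ vnorm u * vnorm v := by
  simpa [vnorm] using
    Real.sum_mul_le_sqrt_mul_sqrt Finset.univ (fun p => |u p|) (fun p => |v p|)

theorem pinv_mul_self {m n : ℕ} {B : Matrix (Fin m) (Fin n) ℝ} (h : B.rank = n) :
    pinv B * B = 1 := by
  have hu : IsUnit (Bᵀ * B) := by
    rw [← Matrix.linearIndependent_cols_iff_isUnit, linearIndependent_iff_card_eq_finrank_span,
      Set.finrank, ← Matrix.rank_eq_finrank_span_cols, Matrix.rank_transpose_mul_self, h, Fintype.card_fin]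
  rw [pinv, Matrix.mul_assoc]
  exact Matrix.nonsing_inv_mul _ ((Matrix.isUnit_iff_isUnit_det _).1 hu)

/-- Scaling a vector by `d` is controlled by the image under `B * diagonal d`. -/
theorem mul_abs_le_spec_pinv_mul {m n : ℕ} {B : Matrix (Fin m) (Fin n) ℝ} (h : B.rank = n)
    {d : Fin n → ℝ} (hd : ∀ i, 0 < d i) (x : Fin n → ℝ) (k : Fin n) :
    d k * |x k| ≤ spec (pinv B) * vnorm ((B * diagonal d) *ᵥ x) := by
  have hx : pinv B *ᵥ ((B * diagonal d) *ᵥ x) = diagonal d *ᵥ x := by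
    rw [Matrix.mulVec_mulVec, ← Matrix.mul_assoc, pinv_mul_self h, Matrix.one_mul]
  calc d k * |x k| = |(diagonal d *ᵥ x) k| := by
        rw [Matrix.mulVec_diagonal, abs_mul, abs_of_pos (hd k)]
    _ ≤ vnorm (diagonal d *ᵥ x) := abs_le_vnorm _ k
    _ ≤ _ := hx ▸ vnorm_mulVec_le _ _

/-- bound on |(Ṽᵀ ΔM Ṽ)_{ij}|. -/
theorem stmt_2 {m n : ℕ} (A B : Matrix (Fin m) (Fin n) ℝ)
    (d : Fin n → ℝ) (hd : ∀ i, 0 < d i)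
    (hA : A = B * Matrix.diagonal d) (hrank : A.rank = n)
    (V : Matrix (Fin n) (Fin n) ℝ) (hV : Vᵀ * V = 1)
    (ΔM : Matrix (Fin n) (Fin n) ℝ) (ε : ℝ) (hε : 0 ≤ ε)
    (hΔM : ∀ i j, |ΔM i j| ≤
      ε * (((A.map (fun x => |x|))ᵀ * A.map (fun x => |x|)) i j)) :
    ∀ i j, |(Vᵀ * ΔM * V) i j| ≤ (n : ℝ)^2 * ε * kappa B ^ 2 *
      (vnorm (fun k => (A * V) k i) * vnorm (fun k => (A * V) k j)) := by
  intro i j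
  subst hA
  have hB : B.rank = n := le_antisymm
    (by simpa using B.rank_le_width) (hrank.ge.trans (Matrix.rank_mul_le_left B (diagonal d)))
  have hentry (k l : Fin n) : |ΔM k l| ≤ ε * spec B ^ 2 * (d k * d l) := by
    refine (hΔM k l).trans ?_
    have hsum : (((B * diagonal d).map (fun x => |x|))ᵀ * (B * diagonal d).map (fun x => |x|)) k l
        = d k * d l * ∑ p, |B.col k p| * |B.col l p| := by
      simp only [Matrix.mul_apply, Matrix.transpose_apply, Matrix.map_apply, Matrix.col_apply,
        Finset.mul_sum]
      simp only [← Matrix.mul_apply, Matrix.mul_diagonal, abs_mul, abs_of_pos (hd _)]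
      exact Finset.sum_congr rfl fun p _ => by ring
    have hcol : ∑ p, |B.col k p| * |B.col l p| ≤ spec B ^ 2 :=
      (sum_abs_mul_abs_le _ _).trans <| by
        rw [sq]
        exact mul_le_mul (vnorm_col_le_spec B k) (vnorm_col_le_spec B l) (vnorm_nonneg _)
          (spec_nonneg B)
    have hdd : 0 ≤ d k * d l := (mul_pos (hd k) (hd l)).le
    rw [hsum]
    calc ε * (d k * d l * ∑ p, |B.col k p| * |B.col l p|)
        ≤ ε * (d k * d l * spec B ^ 2) := by gcongr
      _ = _ := by ring
  have hcolV (i k : Fin n) : d k * |V k i| ≤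
      spec (pinv B) * vnorm (fun p => (B * diagonal d * V) p i) :=
    mul_abs_le_spec_pinv_mul hB hd (V.col i) k
  set a := vnorm (fun p => (B * diagonal d * V) p i)
  set b := vnorm (fun p => (B * diagonal d * V) p j)
  have hterm (k l : Fin n) : |V k i * ΔM k l * V l j| ≤ ε * kappa B ^ 2 * (a * b) := by
    have hprod := mul_le_mul (hcolV i k) (hcolV j l) (mul_nonneg (hd l).le (abs_nonneg _))
      ((mul_nonneg (hd k).le (abs_nonneg _)).trans (hcolV i k))
    rw [abs_mul, abs_mul]
    calc |V k i| * |ΔM k l| * |V l j|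
        ≤ |V k i| * (ε * spec B ^ 2 * (d k * d l)) * |V l j| := by gcongr; exact hentry k l
      _ = ε * spec B ^ 2 * (d k * |V k i| * (d l * |V l j|)) := by ring
      _ ≤ ε * spec B ^ 2 * (spec (pinv B) * a * (spec (pinv B) * b)) := by gcongr
      _ = _ := by rw [kappa]; ring
  have hexp : (Vᵀ * ΔM * V) i j = ∑ l, ∑ k, V k i * ΔM k l * V l j := by
    simp only [Matrix.mul_apply, Matrix.transpose_apply, Finset.sum_mul]
  rw [hexp]
  calc |∑ l, ∑ k, V k i * ΔM k l * V l j|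
      ≤ ∑ l, ∑ k, |V k i * ΔM k l * V l j| :=
        (Finset.abs_sum_le_sum_abs _ _).trans
          (Finset.sum_le_sum fun l _ => Finset.abs_sum_le_sum_abs _ _)
    _ ≤ ∑ _l : Fin n, ∑ _k : Fin n, ε * kappa B ^ 2 * (a * b) :=
        Finset.sum_le_sum fun l _ => Finset.sum_le_sum fun k _ => hterm k l
    _ = _ := by
        simp only [Finset.sum_const, Finset.card_univ, Fintype.card_fin, nsmul_eq_mul]
        ring
end

section
/- Let R be a real invertible n×n matrix and ΔR a real n×n matrix with ‖ΔR R⁻¹‖ < 1. Suppose R + ΔR = U Σ Vᵀ where U and V are n×n orthogonal matrices and Σ is a diagonal matrix with nonnegative diagonal entries. Then for all i, j ≤ n, |(Vᵀ ΔRᵀ U Σ)_{ij}| ≤ (‖ΔR R⁻¹‖ / (1 − ‖ΔR R⁻¹‖)) · Σ_{ii} · Σ_{jj}. -/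
open Matrix BigOperators

/-- The spectral norm bounds the Euclidean norm of a matrix-vector product. -/
theorem norm_toLp_mulVec_le_spec {m n : ℕ} (A : Matrix (Fin m) (Fin n) ℝ) (x : Fin n → ℝ) :
    ‖WithLp.toLp 2 (A *ᵥ x)‖ ≤ spec A * ‖WithLp.toLp 2 x‖ :=
  (Matrix.toEuclideanLin A).toContinuousLinearMap.le_opNorm (WithLp.toLp 2 x)

/-- The columns of a matrix with orthonormal columns are unit vectors. -/
theorem norm_toLp_col_eq_one {m n : ℕ} {U : Matrix (Fin m) (Fin n) ℝ} (hU : Uᵀ * U = 1)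
    (j : Fin n) : ‖WithLp.toLp 2 (U.col j)‖ = 1 := by
  have h : (Uᵀ * U) j j = 1 := by simp [hU]
  rw [EuclideanSpace.norm_eq, Real.sqrt_eq_one, ← h, Matrix.mul_apply]
  simp [sq]

/-- If `x + E x` has norm at most `s` and `‖E‖ < 1`, then `E x` has norm at most
`‖E‖ / (1 - ‖E‖) * s`. -/
theorem norm_toLp_mulVec_le_of_norm_add_le {n : ℕ} {E : Matrix (Fin n) (Fin n) ℝ}
    (hE : spec E < 1) {x : Fin n → ℝ} {s : ℝ} (hx : ‖WithLp.toLp 2 (x + E *ᵥ x)‖ ≤ s) :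
    ‖WithLp.toLp 2 (E *ᵥ x)‖ ≤ spec E / (1 - spec E) * s := by
  have h1 := norm_toLp_mulVec_le_spec E x
  have h0 : 0 ≤ spec E := norm_nonneg _
  have h2 : ‖WithLp.toLp 2 x‖ - ‖WithLp.toLp 2 (E *ᵥ x)‖ ≤ ‖WithLp.toLp 2 (x + E *ᵥ x)‖ := by
    rw [WithLp.toLp_add]
    exact norm_sub_le_norm_add _ _
  have h3 : (1 - spec E) * ‖WithLp.toLp 2 x‖ ≤ s := by linarith
  rw [div_mul_eq_mul_div, le_div_iff₀ (by linarith)]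
  calc ‖WithLp.toLp 2 (E *ᵥ x)‖ * (1 - spec E)
      ≤ spec E * ‖WithLp.toLp 2 x‖ * (1 - spec E) :=
        mul_le_mul_of_nonneg_right h1 (by linarith)
    _ = spec E * ((1 - spec E) * ‖WithLp.toLp 2 x‖) := by ring
    _ ≤ spec E * s := mul_le_mul_of_nonneg_left h3 h0

/-- bound on |(Vᵀ ΔRᵀ U Σ)_{ij}|. -/
theorem stmt_14 {n : ℕ} (R ΔR U V : Matrix (Fin n) (Fin n) ℝ)
    (hR : IsUnit R.det)
    (hsmall : spec (ΔR * R⁻¹) < 1)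
    (hU : Uᵀ * U = 1) (hV : Vᵀ * V = 1)
    (σ : Fin n → ℝ) (hσ : ∀ i, 0 ≤ σ i)
    (hsvd : R + ΔR = U * Matrix.diagonal σ * Vᵀ) :
    ∀ i j, |(Vᵀ * ΔRᵀ * U * Matrix.diagonal σ) i j|
      ≤ spec (ΔR * R⁻¹) / (1 - spec (ΔR * R⁻¹)) * (σ i * σ j) := by
  intro i j
  have hE : (ΔR * R⁻¹) *ᵥ (R *ᵥ V.col i) = ΔR *ᵥ V.col i := by
    rw [Matrix.mulVec_mulVec, Matrix.nonsing_inv_mul_cancel_right _ _ hR]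
  have hcol : R *ᵥ V.col i + (ΔR * R⁻¹) *ᵥ (R *ᵥ V.col i) = σ i • U.col i := by
    have h : (R + ΔR) * V = U * Matrix.diagonal σ := by
      rw [hsvd, Matrix.mul_assoc, hV, Matrix.mul_one]
    rw [hE, ← Matrix.add_mulVec]
    ext k
    have hk := congrFun (congrFun h k) i
    rw [Matrix.mul_diagonal, mul_comm] at hk
    exact hk
  have hx : ‖WithLp.toLp 2 (R *ᵥ V.col i + (ΔR * R⁻¹) *ᵥ (R *ᵥ V.col i))‖ ≤ σ i := by
    rw [hcol, WithLp.toLp_smul, norm_smul, norm_toLp_col_eq_one hU, mul_one,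
      Real.norm_of_nonneg (hσ i)]
  have hbound := norm_toLp_mulVec_le_of_norm_add_le hsmall hx
  rw [hE] at hbound
  have hentry : (Vᵀ * ΔRᵀ * U) i j =
      inner ℝ (WithLp.toLp 2 (U.col j)) (WithLp.toLp 2 (ΔR *ᵥ V.col i)) := by
    rw [← Matrix.transpose_mul, EuclideanSpace.inner_toLp_toLp]
    rfl
  have hinner : |(Vᵀ * ΔRᵀ * U) i j| ≤ ‖WithLp.toLp 2 (ΔR *ᵥ V.col i)‖ := by
    rw [hentry]
    simpa [norm_toLp_col_eq_one hU] using
      abs_real_inner_le_norm (WithLp.toLp 2 (U.col j)) (WithLp.toLp 2 (ΔR *ᵥ V.col i))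
  rw [Matrix.mul_diagonal, abs_mul, abs_of_nonneg (hσ j), ← mul_assoc]
  exact mul_le_mul_of_nonneg_right (hinner.trans hbound) (hσ j)
end

section
/- (Scaling invariance of the Cholesky QR error model.) Let A = B·D be a real m×n matrix where D is an n×n diagonal matrix with positive diagonal entries. Suppose M̂ = AᵀA + ΔM with |ΔM| ≤ ε_M |A|ᵀ|A| entrywise; M̂ + ΔM̂ = R̂ᵀR̂ with |ΔM̂| ≤ ε_chol |R̂ᵀ||R̂| entrywise; and for each row index i ≤ m, Q̂(i,:)·(R̂ + ΔR_i) = A(i,:) with |ΔR_i| ≤ ε_trsm |R̂| entrywise. Define M̂' := D⁻¹ M̂ D⁻¹ and R̂' := R̂ D⁻¹. Then M̂' = BᵀB + ΔM' with |ΔM'| ≤ ε_M |B|ᵀ|B| entrywise; M̂' + ΔM̂' = R̂'ᵀR̂' with ΔM̂' := D⁻¹ ΔM̂ D⁻¹ satisfying |ΔM̂'| ≤ ε_chol |R̂'ᵀ||R̂'| entrywise; and for each row i, Q̂(i,:)·(R̂' + ΔR_i D⁻¹) = B(i,:) with |ΔR_i D⁻¹| ≤ ε_trsm |R̂'| entrywise.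 In particular, the computed Q-factor Q̂ of A satisfies the Cholesky QR error model for B with the same relative error parameters. -/
open Matrix BigOperators

/-- The Gram matrix of a column-scaled matrix is the Gram matrix scaled on both sides. -/
theorem transpose_mul_self_mul_diagonal {ι κ R : Type*} [Fintype ι] [Fintype κ] [DecidableEq κ]
    [CommSemiring R] (C : Matrix ι κ R) (c : κ → R) :
    (C * Matrix.diagonal c)ᵀ * (C * Matrix.diagonal c) =
      Matrix.diagonal c * (Cᵀ * C) * Matrix.diagonal c := by
  simp only [Matrix.transpose_mul, Matrix.diagonal_transpose, Matrix.mul_assoc]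

/-- Taking entrywise absolute values commutes with a diagonal column scaling. -/
theorem map_abs_mul_diagonal {ι κ R : Type*} [Fintype κ] [DecidableEq κ]
    [CommRing R] [LinearOrder R] [IsStrictOrderedRing R] (C : Matrix ι κ R) (c : κ → R) :
    (C * Matrix.diagonal c).map (fun x => |x|) =
      C.map (fun x => |x|) * Matrix.diagonal (fun i => |c i|) := by
  ext i j
  simp [Matrix.mul_diagonal, abs_mul]

/-- An entrywise bound by the Gram matrix of `|C|` is preserved by two-sided diagonal scaling. -/
theorem abs_diagonal_mul_mul_diagonal_le {ι κ R : Type*} [Fintype ι] [Fintype κ] [DecidableEq κ]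
    [CommRing R] [LinearOrder R] [IsStrictOrderedRing R]
    {C : Matrix ι κ R} {X : Matrix κ κ R} {ε : R} (c : κ → R)
    (h : ∀ i j, |X i j| ≤
      ε * (((C.map (fun x => |x|))ᵀ * C.map (fun x => |x|)) i j)) (i j : κ) :
    |(Matrix.diagonal c * X * Matrix.diagonal c) i j| ≤
      ε * ((((C * Matrix.diagonal c).map (fun x => |x|))ᵀ *
        (C * Matrix.diagonal c).map (fun x => |x|)) i j) := by
  rw [map_abs_mul_diagonal, transpose_mul_self_mul_diagonal, Matrix.mul_diagonal,
    Matrix.diagonal_mul, Matrix.mul_diagonal, Matrix.diagonal_mul, abs_mul, abs_mul]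
  calc |c i| * |X i j| * |c j|
      ≤ |c i| * (ε * (((C.map (fun x => |x|))ᵀ * C.map (fun x => |x|)) i j)) * |c j| := by
        gcongr
        exact h i j
    _ = _ := by ring

/-- scaling invariance of the Cholesky QR error model. -/
theorem stmt_19 {m n : ℕ} (A B : Matrix (Fin m) (Fin n) ℝ)
    (d : Fin n → ℝ) (hd : ∀ i, 0 < d i)
    (hA : A = B * Matrix.diagonal d)
    (Mh ΔM ΔMh Rh : Matrix (Fin n) (Fin n) ℝ)
    (εM εchol εtrsm : ℝ)
    (hεM : 0 ≤ εM) (hεchol : 0 ≤ εchol) (hεtrsm : 0 ≤ εtrsm)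
    (hMh : Mh = Aᵀ * A + ΔM)
    (hΔM : ∀ i j, |ΔM i j| ≤
      εM * (((A.map (fun x => |x|))ᵀ * A.map (fun x => |x|)) i j))
    (hchol : Mh + ΔMh = Rhᵀ * Rh)
    (hΔMh : ∀ i j, |ΔMh i j| ≤
      εchol * (((Rh.map (fun x => |x|))ᵀ * Rh.map (fun x => |x|)) i j))
    (Q : Matrix (Fin m) (Fin n) ℝ)
    (ΔR : Fin m → Matrix (Fin n) (Fin n) ℝ)
    (htrsm : ∀ i, Matrix.vecMul (fun j => Q i j) (Rh + ΔR i) = fun j => A i j)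
    (hΔR : ∀ i, ∀ k l, |ΔR i k l| ≤ εtrsm * |Rh k l|) :
    (Matrix.diagonal (fun i => (d i)⁻¹) * Mh * Matrix.diagonal (fun i => (d i)⁻¹)
        = Bᵀ * B + Matrix.diagonal (fun i => (d i)⁻¹) * ΔM *
            Matrix.diagonal (fun i => (d i)⁻¹) ∧
      ∀ i j, |(Matrix.diagonal (fun i => (d i)⁻¹) * ΔM *
          Matrix.diagonal (fun i => (d i)⁻¹)) i j| ≤
        εM * (((B.map (fun x => |x|))ᵀ * B.map (fun x => |x|)) i j)) ∧
    (Matrix.diagonal (fun i => (d i)⁻¹) * Mh * Matrix.diagonal (fun i => (d i)⁻¹)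
        + Matrix.diagonal (fun i => (d i)⁻¹) * ΔMh *
            Matrix.diagonal (fun i => (d i)⁻¹)
        = (Rh * Matrix.diagonal (fun i => (d i)⁻¹))ᵀ *
            (Rh * Matrix.diagonal (fun i => (d i)⁻¹)) ∧
      ∀ i j, |(Matrix.diagonal (fun i => (d i)⁻¹) * ΔMh *
          Matrix.diagonal (fun i => (d i)⁻¹)) i j| ≤
        εchol * ((((Rh * Matrix.diagonal (fun i => (d i)⁻¹)).map (fun x => |x|))ᵀ *
          (Rh * Matrix.diagonal (fun i => (d i)⁻¹)).map (fun x => |x|)) i j) ∧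
    (∀ i, Matrix.vecMul (fun j => Q i j)
        (Rh * Matrix.diagonal (fun i => (d i)⁻¹) +
          ΔR i * Matrix.diagonal (fun i => (d i)⁻¹)) = fun j => B i j) ∧
    (∀ i, ∀ k l, |(ΔR i * Matrix.diagonal (fun i => (d i)⁻¹)) k l| ≤
      εtrsm * |(Rh * Matrix.diagonal (fun i => (d i)⁻¹)) k l|)) := by
  have hB : B = A * Matrix.diagonal (fun i => (d i)⁻¹) := by
    ext i j
    simp [hA, Matrix.mul_diagonal, (hd j).ne']
  refine ⟨⟨?_, ?_⟩, ?_, fun i j =>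
    ⟨abs_diagonal_mul_mul_diagonal_le _ hΔMh i j, fun i => ?_, fun i k l => ?_⟩⟩
  · rw [hB, transpose_mul_self_mul_diagonal, hMh, Matrix.mul_add, Matrix.add_mul]
  · rw [hB]
    exact abs_diagonal_mul_mul_diagonal_le _ hΔM
  · rw [transpose_mul_self_mul_diagonal, ← hchol, Matrix.mul_add, Matrix.add_mul]
  · rw [← Matrix.add_mul, ← Matrix.vecMul_vecMul, htrsm, hB]
    ext j
    rw [Matrix.vecMul_diagonal, Matrix.mul_diagonal]
  · rw [Matrix.mul_diagonal, Matrix.mul_diagonal, abs_mul, abs_mul, ← mul_assoc]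
    gcongr
    exact hΔR i k l
end
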